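/- Let V and V' be free bigraded R-modules, bounded below and concentrated in strictly positive total degrees, and let f : T[V] → T[V'] be a multimorphism of bigraded algebras, that is, a filtration-preserving degree-0 multimorphism with f^0(1) = 1, f^k(1) = 0 for k > 0, and f^k(ab) = Σ_{i+j=k} f^i(a) f^j(b) for all k. Let α₁ : V → V' be its first component, namely the restriction of f to V ⊆ T[V] followed by the projection onto V' ⊆ T[V']. Then f is an isomorphism of bigraded algebras (it admits a two-sided inverse multimorphism of bigraded algebras under convolution composition) if and only if α₁ is an isomorphism of bigraded R-modules (an invertible filtration-preserving degree-0 multimorphism). -/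

import Mathlib

/-!
Framework: bigraded algebras are treated as internally graded `R`-algebras, i.e.
an `R`-algebra `A` with a family `𝒜 : ℤ × ℤ → Submodule R A` which is an internal
direct sum decomposition, compatible with the multiplication.  A multimorphism of
degree `0` is encoded by its family of components `f : ℕ → (A →ₗ[R] B)`, where
`f k` lowers column degree by `k` and raises row (complementary) degree by `k`;
composition of multimorphisms is by convolution.  For the tensor algebra `T[V]` on
a bigraded module `V` the induced bigrading is generated by products of
homogeneous elements of `V`.
-/

section TensorPreamble

variable (R : Type) [CommRing R]

/-- Convolution composition of multimorphisms: `(g ∘ f)^k = ∑_{i+j=k} g^i f^j`. -/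
def convE {A B C : Type} [AddCommGroup A] [Module R A] [AddCommGroup B] [Module R B]
    [AddCommGroup C] [Module R C] (g : ℕ → (B →ₗ[R] C)) (f : ℕ → (A →ₗ[R] B)) :
    ℕ → (A →ₗ[R] C) :=
  fun k => ∑ i ∈ Finset.range (k + 1), (g i).comp (f (k - i))

/-- The identity multimorphism. -/
def idE (A : Type) [AddCommGroup A] [Module R A] : ℕ → (A →ₗ[R] A) :=
  fun k => if k = 0 then LinearMap.id else 0

/-- Totalization of a multimorphism (pointwise, a finite sum in each argument in the
bounded situations considered below). -/
noncomputable def totE {A B : Type} [AddCommGroup A] [Module R A] [AddCommGroup B]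
    [Module R B] (f : ℕ → (A →ₗ[R] B)) : A → B :=
  fun x => ∑ᶠ k, f k x

variable (V : Type) [AddCommGroup V] [Module R V]

/-- The grading induced on the tensor algebra `T[V]` by a grading `𝒱` of `V`:
the piece of degree `n` is generated by all products of homogeneous elements of `V`
whose degrees add up to `n`. -/
def tGrade {ι : Type} [AddCommMonoid ι] (𝒱 : ι → Submodule R V) (n : ι) :
    Submodule R (TensorAlgebra R V) :=
  ⨆ (l : List ι) (_ : l.sum = n),
    (l.map fun i => Submodule.map (TensorAlgebra.ι R (M := V)) (𝒱 i)).prod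

/-- `V` (with grading `𝒱`) is a generating bigraded module for a free connected
multialgebra: the grading is an internal direct sum decomposition, concentrated in
strictly positive total degrees, and bounded below. -/
def IsFreeConnectedGen (𝒱 : ℤ × ℤ → Submodule R V) : Prop :=
  DirectSum.IsInternal 𝒱 ∧
  (∀ pq : ℤ × ℤ, pq.1 + pq.2 ≤ 0 → 𝒱 pq = ⊥) ∧
  (∀ n : ℤ, ∃ s : ℤ, ∀ pq : ℤ × ℤ, pq.1 + pq.2 = n → pq.1 < s → 𝒱 pq = ⊥)

/-- A multialgebra structure: `𝒜` is an internal bigrading of the `R`-algebra `A`,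
bounded below, and `d` is a multidifferential each of whose components satisfies the
Leibniz rule. -/
def IsMultialgebra (A : Type) [Ring A] [Algebra R A] (𝒜 : ℤ × ℤ → Submodule R A)
    (d : ℕ → (A →ₗ[R] A)) : Prop :=
  DirectSum.IsInternal 𝒜 ∧
  (1 : A) ∈ 𝒜 (0, 0) ∧
  (∀ pq pq' : ℤ × ℤ, ∀ a ∈ 𝒜 pq, ∀ b ∈ 𝒜 pq', a * b ∈ 𝒜 (pq.1 + pq'.1, pq.2 + pq'.2)) ∧
  (∀ n : ℤ, ∃ s : ℤ, ∀ pq : ℤ × ℤ, pq.1 + pq.2 = n → pq.1 < s → 𝒜 pq = ⊥) ∧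
  (∀ (i : ℕ) (pq : ℤ × ℤ), ∀ a ∈ 𝒜 pq, d i a ∈ 𝒜 (pq.1 - i, pq.2 + i - 1)) ∧
  (∀ (i : ℕ) (pq : ℤ × ℤ), ∀ a ∈ 𝒜 pq, ∀ b : A,
    d i (a * b) = d i a * b + (((-1 : ℤˣ) ^ (pq.1 + pq.2) : ℤˣ) : ℤ) • (a * d i b)) ∧
  (∀ n : ℕ, ∑ i ∈ Finset.range (n + 1), (d i).comp (d (n - i)) = 0)

/-- A morphism of multialgebras `(A, 𝒜, dA) → (B, ℬ, dB)`, given by its components. -/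
def IsMAlgMorphism {A B : Type} [Ring A] [Algebra R A] [Ring B] [Algebra R B]
    (𝒜 : ℤ × ℤ → Submodule R A) (ℬ : ℤ × ℤ → Submodule R B)
    (dA : ℕ → (A →ₗ[R] A)) (dB : ℕ → (B →ₗ[R] B)) (f : ℕ → (A →ₗ[R] B)) : Prop :=
  (∀ (k : ℕ) (pq : ℤ × ℤ), ∀ a ∈ 𝒜 pq, f k a ∈ ℬ (pq.1 - k, pq.2 + k)) ∧
  (∀ k, ∑ i ∈ Finset.range (k + 1), (dB i).comp (f (k - i)) =
    ∑ i ∈ Finset.range (k + 1), (f i).comp (dA (k - i))) ∧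
  (f 0 1 = 1) ∧ (∀ k, 0 < k → f k 1 = 0) ∧
  (∀ (k : ℕ) (a b : A), f k (a * b) = ∑ i ∈ Finset.range (k + 1), f i a * f (k - i) b)

/-- A multihomotopy of morphisms of multialgebras from `f` to `g`: `H k` encodes the
component `h^{k-1}` (so that the component `h^{-1}` is allowed), and `H` is an
`f`-`g`-multiderivation. -/
def IsMAlgHomotopy {A B : Type} [Ring A] [Algebra R A] [Ring B] [Algebra R B]
    (𝒜 : ℤ × ℤ → Submodule R A) (ℬ : ℤ × ℤ → Submodule R B)
    (dA : ℕ → (A →ₗ[R] A)) (dB : ℕ → (B →ₗ[R] B)) (f g H : ℕ → (A →ₗ[R] B)) : Prop :=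
  (∀ (k : ℕ) (pq : ℤ × ℤ), ∀ a ∈ 𝒜 pq, H k a ∈ ℬ (pq.1 - k + 1, pq.2 + k)) ∧
  (∀ m, ∑ i ∈ Finset.range (m + 1), ((dB i).comp (H (m - i)) + (H i).comp (dA (m - i))) =
    if m = 0 then 0 else g (m - 1) - f (m - 1)) ∧
  (∀ (k : ℕ) (pq : ℤ × ℤ), ∀ a ∈ 𝒜 pq, ∀ b : A,
    H k (a * b) = ∑ i ∈ Finset.range (k + 1),
      (H i a * g (k - i) b +
        (((-1 : ℤˣ) ^ (pq.1 + pq.2) : ℤˣ) : ℤ) • (f (k - i) a * H i b)))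

/-- A morphism of (internally graded) multicomplexes, given by its components. -/
def IsMCMorphismI {V W : Type} [AddCommGroup V] [Module R V] [AddCommGroup W] [Module R W]
    (𝒱 : ℤ × ℤ → Submodule R V) (𝒲 : ℤ × ℤ → Submodule R W)
    (dV : ℕ → (V →ₗ[R] V)) (dW : ℕ → (W →ₗ[R] W)) (f : ℕ → (V →ₗ[R] W)) : Prop :=
  (∀ (k : ℕ) (pq : ℤ × ℤ), ∀ v ∈ 𝒱 pq, f k v ∈ 𝒲 (pq.1 - k, pq.2 + k)) ∧
  ∀ k, ∑ i ∈ Finset.range (k + 1), (dW i).comp (f (k - i)) =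
    ∑ i ∈ Finset.range (k + 1), (f i).comp (dV (k - i))

/-- A multihomotopy of morphisms of (internally graded) multicomplexes from `f` to `g`;
`H k` encodes the component `h^{k-1}`. -/
def IsMCHomotopyI {V W : Type} [AddCommGroup V] [Module R V] [AddCommGroup W] [Module R W]
    (𝒱 : ℤ × ℤ → Submodule R V) (𝒲 : ℤ × ℤ → Submodule R W)
    (dV : ℕ → (V →ₗ[R] V)) (dW : ℕ → (W →ₗ[R] W)) (f g H : ℕ → (V →ₗ[R] W)) : Prop :=
  (∀ (k : ℕ) (pq : ℤ × ℤ), ∀ v ∈ 𝒱 pq, H k v ∈ 𝒲 (pq.1 - k + 1, pq.2 + k)) ∧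
  ∀ m, ∑ i ∈ Finset.range (m + 1), ((dW i).comp (H (m - i)) + (H i).comp (dV (m - i))) =
    if m = 0 then 0 else g (m - 1) - f (m - 1)

/-- The linear part `β₁` of a multidifferential `d` on `T[V]`: the component of the
restriction of `d` to `V` which lands in `V ⊆ T[V]`. -/
noncomputable def betaOne (d : ℕ → (TensorAlgebra R V →ₗ[R] TensorAlgebra R V)) (i : ℕ) :
    V →ₗ[R] V :=
  (TensorAlgebra.ιInv (R := R) (M := V)).comp ((d i).comp (TensorAlgebra.ι R))

/-- The `q`-th column filtration level of an internally bigraded module. -/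
def colFilI {A : Type} [AddCommGroup A] [Module R A] (𝒜 : ℤ × ℤ → Submodule R A)
    (q : ℤ) : Submodule R A :=
  ⨆ (pq : ℤ × ℤ) (_ : pq.1 ≤ q), 𝒜 pq

/-- The totalization of the multimorphism `g` restricts, on every column filtration
level, to a homology isomorphism (weak multiequivalence, cf. Lemma 1.12.3). -/
def InducesColHomologyIsoI {A B : Type} [AddCommGroup A] [Module R A] [AddCommGroup B]
    [Module R B] (𝒜 : ℤ × ℤ → Submodule R A) (ℬ : ℤ × ℤ → Submodule R B)
    (dA : ℕ → (A →ₗ[R] A)) (dB : ℕ → (B →ₗ[R] B)) (g : ℕ → (A →ₗ[R] B)) : Prop :=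
  ∀ q : ℤ,
    (∀ y ∈ colFilI R ℬ q, totE R dB y = 0 →
      ∃ x ∈ colFilI R 𝒜 q, ∃ z ∈ colFilI R ℬ q,
        totE R dA x = 0 ∧ y = totE R g x + totE R dB z) ∧
    (∀ x ∈ colFilI R 𝒜 q, totE R dA x = 0 →
      (∃ z ∈ colFilI R ℬ q, totE R g x = totE R dB z) →
      ∃ w ∈ colFilI R 𝒜 q, x = totE R dA w)

end TensorPreamble

section Convolution

open Finset

theorem Finset.Nat.sum_antidiagonal_assoc {M : Type*} [AddCommMonoid M] (s : ℕ → ℕ → ℕ → M)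
    (n : ℕ) :
    ∑ p ∈ antidiagonal n, ∑ q ∈ antidiagonal p.2, s p.1 q.1 q.2 =
      ∑ p ∈ antidiagonal n, ∑ q ∈ antidiagonal p.1, s q.1 q.2 p.2 := by
  simp_rw [sum_sigma']
  refine sum_nbij' (fun x => ⟨(x.1.1 + x.2.1, x.2.2), (x.1.1, x.2.1)⟩)
    (fun x => ⟨(x.2.1, x.2.2 + x.1.2), (x.2.2, x.1.2)⟩) ?_ ?_ ?_ ?_ ?_ <;>
  · rintro ⟨⟨a, b⟩, c, d⟩ h
    simp only [mem_sigma, HasAntidiagonal.mem_antidiagonal] at h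
    obtain ⟨rfl, rfl⟩ := h
    simp [add_assoc]

theorem Finset.Nat.sum_antidiagonal_interchange {M : Type*} [AddCommMonoid M]
    (s : ℕ → ℕ → ℕ → ℕ → M) (n : ℕ) :
    ∑ p ∈ antidiagonal n, ∑ q ∈ antidiagonal p.2, ∑ r ∈ antidiagonal p.1,
        s r.1 q.1 r.2 q.2 =
      ∑ p ∈ antidiagonal n, ∑ q ∈ antidiagonal p.1, ∑ r ∈ antidiagonal p.2,
        s q.1 q.2 r.1 r.2 := by
  simp_rw [sum_sigma']
  refine sum_nbij'
    (fun x => ⟨(x.2.2.1 + x.2.1.1, x.2.2.2 + x.2.1.2), (x.2.2.1, x.2.1.1), (x.2.2.2, x.2.1.2)⟩)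
    (fun x => ⟨(x.2.1.1 + x.2.2.1, x.2.1.2 + x.2.2.2), (x.2.1.2, x.2.2.2), (x.2.1.1, x.2.2.1)⟩)
    ?_ ?_ ?_ ?_ ?_ <;>
  · rintro ⟨⟨a, b⟩, ⟨c, d⟩, e, f⟩ h
    simp only [mem_sigma, HasAntidiagonal.mem_antidiagonal] at h
    obtain ⟨rfl, rfl, rfl⟩ := h
    simp [add_add_add_comm]

variable {R A B C : Type} [CommRing R] [AddCommGroup A] [Module R A] [AddCommGroup B]
  [Module R B] [AddCommGroup C] [Module R C]

theorem convE_apply (g : ℕ → (B →ₗ[R] C)) (f : ℕ → (A →ₗ[R] B)) (k : ℕ) (x : A) :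
    convE R g f k x = ∑ p ∈ antidiagonal k, g p.1 (f p.2 x) := by
  rw [Nat.sum_antidiagonal_eq_sum_range_succ (fun i j => g i (f j x))]
  simp [convE]

/-- Convolution with `f` is injective on sequences of elements as soon as `f 0` is injective. -/
theorem conv_injective {f : ℕ → (A →ₗ[R] B)} (hf : Function.Injective (f 0)) {u w : ℕ → A}
    (h : ∀ k, ∑ p ∈ antidiagonal k, f p.1 (u p.2) = ∑ p ∈ antidiagonal k, f p.1 (w p.2)) :
    u = w := by
  funext k
  induction k using Nat.strong_induction_on with
  | _ k ih =>
    have hk := h k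
    rw [Nat.sum_antidiagonal_eq_sum_range_succ (fun i j => f i (u j)),
      Nat.sum_antidiagonal_eq_sum_range_succ (fun i j => f i (w j)),
      sum_range_succ', sum_range_succ'] at hk
    have hs : ∑ i ∈ range k, f (i + 1) (u (k - (i + 1))) =
        ∑ i ∈ range k, f (i + 1) (w (k - (i + 1))) :=
      sum_congr rfl fun i hi => by
        rw [ih _ (by have := mem_range.1 hi; omega)]
    rw [hs] at hk
    exact hf (add_left_cancel hk)

/-- The right convolution inverse of a family `f` whose component `f 0` has the inverse `e`. -/
noncomputable def convInv (f : ℕ → (A →ₗ[R] B)) (e : B →ₗ[R] A) : ℕ → (B →ₗ[R] A)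
  | 0 => e
  | k + 1 => -e.comp (∑ i : Fin (k + 1), (f (i + 1)).comp (convInv f e (k - i)))

theorem convInv_succ (f : ℕ → (A →ₗ[R] B)) (e : B →ₗ[R] A) (k : ℕ) :
    convInv f e (k + 1) =
      -e.comp (∑ i ∈ range (k + 1), (f (i + 1)).comp (convInv f e (k - i))) := by
  rw [convInv, ← Fin.sum_univ_eq_sum_range (fun i => (f (i + 1)).comp (convInv f e (k - i)))]

theorem convE_convInv {f : ℕ → (A →ₗ[R] B)} {e : B →ₗ[R] A} (he : (f 0).comp e = LinearMap.id) :
    convE R f (convInv f e) = idE R B := by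
  funext k
  cases k with
  | zero => simpa [convE, idE, convInv] using he
  | succ k =>
    rw [convE, sum_range_succ']
    simp only [Nat.add_sub_add_right, Nat.sub_zero]
    rw [convInv_succ, LinearMap.comp_neg, ← LinearMap.comp_assoc, he]
    simp [idE]

theorem convE_idE (f : ℕ → (A →ₗ[R] B)) : convE R f (idE R A) = f := by
  funext k
  rw [convE, sum_range_succ, sum_eq_zero]
  · simp [idE]
  · intro i hi
    rw [idE, if_neg (by have := mem_range.1 hi; omega), LinearMap.comp_zero]

theorem idE_convE (f : ℕ → (A →ₗ[R] B)) : convE R (idE R B) f = f := by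
  funext k
  rw [convE, sum_range_succ', sum_eq_zero]
  · simp [idE]
  · intro i _
    rw [idE, if_neg i.succ_ne_zero, LinearMap.zero_comp]

theorem convE_assoc {D : Type} [AddCommGroup D] [Module R D] (h : ℕ → (C →ₗ[R] D))
    (g : ℕ → (B →ₗ[R] C)) (f : ℕ → (A →ₗ[R] B)) :
    convE R h (convE R g f) = convE R (convE R h g) f := by
  funext k
  ext x
  simp only [convE_apply, map_sum]
  exact Nat.sum_antidiagonal_assoc (fun a b c => h a (g b (f c x))) k

theorem convE_eq_id_symm {f : ℕ → (A →ₗ[R] B)} {g : ℕ → (B →ₗ[R] A)}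
    (hf : Function.Injective (f 0)) (h : convE R f g = idE R B) : convE R g f = idE R A := by
  have key : convE R f (convE R g f) = convE R f (idE R A) := by
    rw [convE_assoc, h, idE_convE, convE_idE]
  suffices ∀ x, (fun k => convE R g f k x) = fun k => idE R A k x from
    funext fun k => LinearMap.ext fun x => congrFun (this x) k
  refine fun x => conv_injective hf fun k => ?_
  have := LinearMap.congr_fun (congrFun key k) x
  rwa [convE_apply, convE_apply] at this

end Convolution

section WordGrade

variable {R V V' V'' : Type} [CommRing R] [AddCommGroup V] [Module R V]
  [AddCommGroup V'] [Module R V'] [AddCommGroup V''] [Module R V'']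

/-- The part of the bidegree `n` piece of `T[V]` spanned by words of length at least `m`. -/
def wordGrade (𝒱 : ℤ × ℤ → Submodule R V) (n : ℤ × ℤ) (m : ℕ) :
    Submodule R (TensorAlgebra R V) :=
  ⨆ (l : List (ℤ × ℤ)) (_ : l.sum = n ∧ m ≤ l.length),
    (l.map fun i => Submodule.map (TensorAlgebra.ι R (M := V)) (𝒱 i)).prod

/-- `V` is concentrated in strictly positive total degrees. -/
def IsConnectedGen (𝒱 : ℤ × ℤ → Submodule R V) : Prop :=
  ∀ pq : ℤ × ℤ, pq.1 + pq.2 ≤ 0 → 𝒱 pq = ⊥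

variable {𝒱 : ℤ × ℤ → Submodule R V} {𝒱' : ℤ × ℤ → Submodule R V'}
  {𝒱'' : ℤ × ℤ → Submodule R V''}

theorem prod_le_wordGrade (l : List (ℤ × ℤ)) :
    (l.map fun i => Submodule.map (TensorAlgebra.ι R (M := V)) (𝒱 i)).prod ≤
      wordGrade 𝒱 l.sum l.length :=
  le_iSup₂_of_le l ⟨rfl, le_rfl⟩ le_rfl

theorem wordGrade_anti (n : ℤ × ℤ) {m m' : ℕ} (h : m ≤ m') :
    wordGrade 𝒱 n m' ≤ wordGrade 𝒱 n m :=
  iSup₂_le fun l hl => le_iSup₂_of_le l ⟨hl.1, h.trans hl.2⟩ le_rfl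

theorem wordGrade_zero (n : ℤ × ℤ) : wordGrade 𝒱 n 0 = tGrade R V 𝒱 n := by
  simp [wordGrade, tGrade]

theorem wordGrade_le_tGrade (n : ℤ × ℤ) (m : ℕ) : wordGrade 𝒱 n m ≤ tGrade R V 𝒱 n :=
  wordGrade_zero (𝒱 := 𝒱) n ▸ wordGrade_anti n m.zero_le

theorem tGrade_le_wordGrade_one {n : ℤ × ℤ} (hn : 0 < n.1 + n.2) :
    tGrade R V 𝒱 n ≤ wordGrade 𝒱 n 1 := by
  refine iSup₂_le fun l hl => le_iSup₂_of_le l ⟨hl, ?_⟩ le_rfl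
  rcases l with _ | ⟨i, l⟩
  · subst hl
    simp at hn
  · simp

theorem ι_mem_wordGrade {n : ℤ × ℤ} {v : V} (hv : v ∈ 𝒱 n) :
    TensorAlgebra.ι R v ∈ wordGrade 𝒱 n 1 := by
  have := prod_le_wordGrade (𝒱 := 𝒱) [n]
  simp only [List.map_cons, List.map_nil, List.prod_cons, List.prod_nil, mul_one,
    List.sum_cons, List.sum_nil, add_zero, List.length_singleton] at this
  exact this (Submodule.mem_map_of_mem hv)

theorem ι_mem_tGrade {n : ℤ × ℤ} {v : V} (hv : v ∈ 𝒱 n) :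
    TensorAlgebra.ι R v ∈ tGrade R V 𝒱 n :=
  wordGrade_le_tGrade _ _ (ι_mem_wordGrade hv)

theorem algebraMap_mem_wordGrade (r : R) :
    algebraMap R (TensorAlgebra R V) r ∈ wordGrade 𝒱 0 0 :=
  prod_le_wordGrade (𝒱 := 𝒱) [] (Submodule.mem_one.2 ⟨r, rfl⟩)

theorem mul_mem_wordGrade {n n' : ℤ × ℤ} {m m' : ℕ} {a b : TensorAlgebra R V}
    (ha : a ∈ wordGrade 𝒱 n m) (hb : b ∈ wordGrade 𝒱 n' m') :
    a * b ∈ wordGrade 𝒱 (n + n') (m + m') := by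
  suffices wordGrade 𝒱 n m * wordGrade 𝒱 n' m' ≤ wordGrade 𝒱 (n + n') (m + m') from
    this (Submodule.mul_mem_mul ha hb)
  rw [wordGrade, wordGrade]
  simp_rw [Submodule.iSup_mul, Submodule.mul_iSup]
  refine iSup₂_le fun l hl => iSup₂_le fun l' hl' => ?_
  refine le_iSup₂_of_le (l ++ l') ⟨by simp [hl.1, hl'.1], ?_⟩ (by simp)
  rw [List.length_append]
  exact add_le_add hl.2 hl'.2

theorem IsConnectedGen.wordGrade_eq_bot (h𝒱 : IsConnectedGen 𝒱) {n : ℤ × ℤ} {m : ℕ}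
    (h : n.1 + n.2 < m) : wordGrade 𝒱 n m = ⊥ := by
  have key : ∀ l : List (ℤ × ℤ),
      (l.map fun i => Submodule.map (TensorAlgebra.ι R (M := V)) (𝒱 i)).prod = ⊥ ∨
        (l.length : ℤ) ≤ l.sum.1 + l.sum.2 := by
    intro l
    induction l with
    | nil => simp
    | cons i l ih =>
      rw [List.map_cons, List.prod_cons]
      by_cases hi : i.1 + i.2 ≤ 0
      · left
        rw [h𝒱 i hi, Submodule.map_bot, Submodule.bot_mul]
      · refine ih.imp (fun h => by rw [h, Submodule.mul_bot]) fun h => ?_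
        simp only [List.length_cons, List.sum_cons, Prod.fst_add, Prod.snd_add]
        push_cast
        omega
  refine eq_bot_iff.2 (iSup₂_le fun l hl => ?_)
  refine ((key l).resolve_right fun h' => ?_).le
  have := hl.2
  rw [hl.1] at h'
  omega

theorem iSup_wordGrade_zero (h𝒱 : ⨆ n, 𝒱 n = ⊤) : ⨆ n, wordGrade 𝒱 n 0 = ⊤ := by
  have hmul : (⨆ n, wordGrade 𝒱 n 0) * (⨆ n, wordGrade 𝒱 n 0) ≤ ⨆ n, wordGrade 𝒱 n 0 := by
    rw [Submodule.iSup_mul]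
    refine iSup_le fun n => ?_
    rw [Submodule.mul_iSup]
    refine iSup_le fun n' => Submodule.mul_le.2 fun a ha b hb => ?_
    exact Submodule.mem_iSup_of_mem (n + n')
      (wordGrade_anti _ zero_le (mul_mem_wordGrade ha hb))
  refine eq_top_iff.2 fun x _ => ?_
  induction x using TensorAlgebra.induction with
  | algebraMap r => exact Submodule.mem_iSup_of_mem 0 (algebraMap_mem_wordGrade r)
  | ι v =>
    have hle : ⨆ n, 𝒱 n ≤ (⨆ n, wordGrade 𝒱 n 0).comap (TensorAlgebra.ι R) :=
      iSup_le fun n v hv =>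
        Submodule.mem_iSup_of_mem n (wordGrade_anti n zero_le_one (ι_mem_wordGrade hv))
    exact hle (h𝒱 ▸ Submodule.mem_top)
  | mul a b ha hb => exact hmul (Submodule.mul_mem_mul (ha trivial) (hb trivial))
  | add a b ha hb => exact add_mem (ha trivial) (hb trivial)

theorem ιInv_ι (v : V) : TensorAlgebra.ιInv (TensorAlgebra.ι R v) = v :=
  TensorAlgebra.ι_leftInverse v

theorem ιInv_algebraMap (r : R) :
    TensorAlgebra.ιInv (algebraMap R (TensorAlgebra R V) r) = 0 := by
  let : Module Rᵐᵒᵖ V := Module.compHom _ ((RingHom.id R).fromOpposite mul_comm)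
  have : IsCentralScalar R V := ⟨fun r m => rfl⟩
  change (TensorAlgebra.toTrivSqZeroExt (algebraMap R (TensorAlgebra R V) r)).snd = 0
  rw [AlgHom.commutes]
  rfl

theorem ιInv_ι_mul_ι_mul (v w : V) (x : TensorAlgebra R V) :
    TensorAlgebra.ιInv (TensorAlgebra.ι R v * (TensorAlgebra.ι R w * x)) = 0 := by
  let : Module Rᵐᵒᵖ V := Module.compHom _ ((RingHom.id R).fromOpposite mul_comm)
  have : IsCentralScalar R V := ⟨fun r m => rfl⟩
  change (TensorAlgebra.toTrivSqZeroExt _).snd = 0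
  simp

theorem ιInv_eq_zero_of_mem_wordGrade {n : ℤ × ℤ} {x : TensorAlgebra R V}
    (hx : x ∈ wordGrade 𝒱 n 2) : TensorAlgebra.ιInv x = 0 := by
  suffices wordGrade 𝒱 n 2 ≤ LinearMap.ker TensorAlgebra.ιInv from this hx
  refine iSup₂_le fun l hl => ?_
  rcases l with _ | ⟨i, _ | ⟨j, l⟩⟩
  · simp at hl
  · simp at hl
  · simp only [List.map_cons, List.prod_cons]
    refine Submodule.mul_le.2 ?_
    rintro _ ⟨v, -, rfl⟩ b hb
    refine Submodule.mul_induction_on hb ?_ fun x y hx hy => ?_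
    · rintro _ ⟨w, -, rfl⟩ x -
      exact ιInv_ι_mul_ι_mul v w x
    · rw [mul_add]
      exact add_mem hx hy

theorem sub_ι_ιInv_mem_wordGrade {n : ℤ × ℤ} {x : TensorAlgebra R V}
    (hx : x ∈ wordGrade 𝒱 n 1) :
    x - TensorAlgebra.ι R (TensorAlgebra.ιInv x) ∈ wordGrade 𝒱 n 2 := by
  suffices wordGrade 𝒱 n 1 ≤ (wordGrade 𝒱 n 2).comap
      (LinearMap.id - (TensorAlgebra.ι R).comp TensorAlgebra.ιInv) from this hx
  refine iSup₂_le fun l hl x hx => ?_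
  simp only [Submodule.mem_comap, LinearMap.sub_apply, LinearMap.id_apply,
    LinearMap.comp_apply]
  rcases Nat.lt_or_ge l.length 2 with h | h
  · obtain ⟨i, rfl⟩ := List.length_eq_one_iff.1 (le_antisymm (Nat.lt_succ_iff.1 h) hl.2)
    simp only [List.map_cons, List.map_nil, List.prod_cons, List.prod_nil, mul_one] at hx
    obtain ⟨v, -, rfl⟩ := hx
    simp [ιInv_ι]
  · have hx2 : x ∈ wordGrade 𝒱 n 2 :=
      (le_iSup₂_of_le (f := fun (l : List (ℤ × ℤ)) (_ : l.sum = n ∧ 2 ≤ l.length) =>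
        (l.map fun i => Submodule.map (TensorAlgebra.ι R (M := V)) (𝒱 i)).prod)
        l ⟨hl.1, h⟩ le_rfl) hx
    rw [ιInv_eq_zero_of_mem_wordGrade hx2, map_zero, sub_zero]
    exact hx2

theorem ιInv_mem_of_mem_tGrade {n : ℤ × ℤ} {x : TensorAlgebra R V}
    (hx : x ∈ tGrade R V 𝒱 n) : TensorAlgebra.ιInv x ∈ 𝒱 n := by
  suffices tGrade R V 𝒱 n ≤ (𝒱 n).comap TensorAlgebra.ιInv from this hx
  refine iSup₂_le fun l hl => ?_
  clear hx
  subst hl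
  intro x hx
  rw [Submodule.mem_comap]
  rcases l with _ | ⟨i, _ | ⟨j, l⟩⟩
  · obtain ⟨r, rfl⟩ := Submodule.mem_one.1 hx
    rw [ιInv_algebraMap]
    exact zero_mem _
  · simp only [List.map_cons, List.map_nil, List.prod_cons, List.prod_nil, mul_one] at hx
    obtain ⟨v, hv, rfl⟩ := hx
    simpa [ιInv_ι] using hv
  · rw [ιInv_eq_zero_of_mem_wordGrade
      (wordGrade_anti _ (by simp) (prod_le_wordGrade (i :: j :: l) hx))]
    exact zero_mem _

/-- A multimorphism of bigraded algebras `T[V] → T[V']`, given by its components. -/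
structure IsMultiAlgHom (𝒱 : ℤ × ℤ → Submodule R V) (𝒱' : ℤ × ℤ → Submodule R V')
    (f : ℕ → (TensorAlgebra R V →ₗ[R] TensorAlgebra R V')) : Prop where
  map_grade : ∀ (k : ℕ) (pq : ℤ × ℤ), ∀ a ∈ tGrade R V 𝒱 pq,
    f k a ∈ tGrade R V' 𝒱' (pq.1 - k, pq.2 + k)
  zero_one : f 0 1 = 1
  pos_one : ∀ k, 0 < k → f k 1 = 0
  map_mul : ∀ (k : ℕ) (a b : TensorAlgebra R V),
    f k (a * b) = ∑ i ∈ Finset.range (k + 1), f i a * f (k - i) b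

/-- The first component `V → V'` of a multimorphism `T[V] → T[V']`. -/
noncomputable def linPart (f : ℕ → (TensorAlgebra R V →ₗ[R] TensorAlgebra R V')) (k : ℕ) :
    V →ₗ[R] V' :=
  (TensorAlgebra.ιInv (R := R) (M := V')).comp ((f k).comp (TensorAlgebra.ι R))

variable {f : ℕ → (TensorAlgebra R V →ₗ[R] TensorAlgebra R V')}

theorem IsMultiAlgHom.map_ι_mem (hf : IsMultiAlgHom 𝒱 𝒱' f) (h𝒱 : IsConnectedGen 𝒱)
    {n : ℤ × ℤ} {v : V} (hv : v ∈ 𝒱 n) (k : ℕ) :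
    f k (TensorAlgebra.ι R v) ∈ wordGrade 𝒱' (n.1 - k, n.2 + k) 1 := by
  by_cases hn : n.1 + n.2 ≤ 0
  · rw [h𝒱 n hn, Submodule.mem_bot] at hv
    simp [hv]
  · refine tGrade_le_wordGrade_one ?_ (hf.map_grade k n _ (ι_mem_tGrade hv))
    simp only
    omega

theorem IsMultiAlgHom.map_wordGrade (hf : IsMultiAlgHom 𝒱 𝒱' f) (h𝒱 : IsConnectedGen 𝒱)
    {n : ℤ × ℤ} {m : ℕ} {x : TensorAlgebra R V} (hx : x ∈ wordGrade 𝒱 n m) (k : ℕ) :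
    f k x ∈ wordGrade 𝒱' (n.1 - k, n.2 + k) m := by
  have key : ∀ (l : List (ℤ × ℤ)) (k : ℕ), ∀ x ∈
      (l.map fun i => Submodule.map (TensorAlgebra.ι R (M := V)) (𝒱 i)).prod,
      f k x ∈ wordGrade 𝒱' (l.sum.1 - k, l.sum.2 + k) l.length := by
    intro l
    induction l with
    | nil =>
      intro k x hx
      obtain ⟨r, rfl⟩ := Submodule.mem_one.1 hx
      rw [Algebra.algebraMap_eq_smul_one, map_smul]
      rcases k.eq_zero_or_pos with rfl | hk
      · rw [hf.zero_one, ← Algebra.algebraMap_eq_smul_one]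
        simpa [Prod.zero_eq_mk] using algebraMap_mem_wordGrade (𝒱 := 𝒱') r
      · simp [hf.pos_one k hk]
    | cons i l ih =>
      intro k x hx
      rw [List.map_cons, List.prod_cons] at hx
      refine Submodule.mul_induction_on hx ?_ fun x y hx hy => ?_
      · rintro _ ⟨v, hv, rfl⟩ b hb
        rw [hf.map_mul]
        refine sum_mem fun j hj => ?_
        have hjk : j ≤ k := Nat.lt_succ_iff.1 (Finset.mem_range.1 hj)
        convert mul_mem_wordGrade (hf.map_ι_mem h𝒱 hv j) (ih (k - j) b hb) using 2
        · ext <;> simp [Nat.cast_sub hjk] <;> ring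
        · simp [add_comm]
      · rw [map_add]
        exact add_mem hx hy
  suffices wordGrade 𝒱 n m ≤ (wordGrade 𝒱' (n.1 - k, n.2 + k) m).comap (f k) from this hx
  refine iSup₂_le fun l hl x hx => ?_
  have := wordGrade_anti _ hl.2 (key l k x hx)
  rwa [hl.1] at this

theorem IsMultiAlgHom.linPart_convE {g : ℕ → (TensorAlgebra R V' →ₗ[R] TensorAlgebra R V'')}
    (hg : IsMultiAlgHom 𝒱' 𝒱'' g) (hf : IsMultiAlgHom 𝒱 𝒱' f) (h𝒱 : IsConnectedGen 𝒱)
    (h𝒱' : IsConnectedGen 𝒱') (htop : ⨆ n, 𝒱 n = ⊤) :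
    convE R (linPart g) (linPart f) = linPart (convE R g f) := by
  funext k
  suffices ⨆ n, 𝒱 n ≤ LinearMap.eqLocus (convE R (linPart g) (linPart f) k)
      (linPart (convE R g f) k) from
    LinearMap.ext fun v => this (htop ▸ Submodule.mem_top)
  refine iSup_le fun n v hv => ?_
  rw [LinearMap.mem_eqLocus, convE_apply, linPart, LinearMap.comp_apply, LinearMap.comp_apply,
    convE_apply, map_sum]
  refine Finset.sum_congr rfl fun p _ => ?_
  have h := ιInv_eq_zero_of_mem_wordGrade
    (hg.map_wordGrade h𝒱' (sub_ι_ιInv_mem_wordGrade (hf.map_ι_mem h𝒱 hv p.2)) p.1)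
  rw [map_sub, map_sub, sub_eq_zero] at h
  exact h.symm

theorem linPart_idE : linPart (idE R (TensorAlgebra R V)) = idE R V := by
  funext k
  ext v
  by_cases hk : k = 0 <;> simp [linPart, idE, hk, ιInv_ι]

theorem IsMultiAlgHom.linPart_mem (hf : IsMultiAlgHom 𝒱 𝒱' f) {n : ℤ × ℤ} {v : V}
    (hv : v ∈ 𝒱 n) (k : ℕ) : linPart f k v ∈ 𝒱' (n.1 - k, n.2 + k) :=
  ιInv_mem_of_mem_tGrade (hf.map_grade k n _ (ι_mem_tGrade hv))

/-- The zeroth component of a multimorphism, as a morphism of algebras. -/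
def IsMultiAlgHom.zeroHom (hf : IsMultiAlgHom 𝒱 𝒱' f) :
    TensorAlgebra R V →ₐ[R] TensorAlgebra R V' :=
  AlgHom.ofLinearMap (f 0) hf.zero_one fun a b => by simpa using hf.map_mul 0 a b

/-- A graded linear map `V → V'` induces a multimorphism `T[V] → T[V']` concentrated in
degree zero. -/
theorem isMultiAlgHom_lift {c : V →ₗ[R] V'} (hc : ∀ n, ∀ v ∈ 𝒱 n, c v ∈ 𝒱' n) :
    IsMultiAlgHom 𝒱 𝒱' fun k =>
      if k = 0 then (TensorAlgebra.lift R ((TensorAlgebra.ι R).comp c)).toLinearMap else 0 where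
  map_grade k n a ha := by
    split_ifs with hk
    · subst hk
      suffices tGrade R V 𝒱 n ≤ (tGrade R V' 𝒱' n).comap
          (TensorAlgebra.lift R ((TensorAlgebra.ι R).comp c)).toLinearMap by
        simpa using this ha
      refine iSup₂_le fun l hl => le_trans ?_ (Submodule.comap_mono (le_iSup₂_of_le l hl le_rfl))
      clear hl ha
      induction l with
      | nil =>
        intro x hx
        obtain ⟨r, rfl⟩ := Submodule.mem_one.1 hx
        exact Submodule.mem_one.2 ⟨r, by simp⟩
      | cons i l ih =>
        simp only [List.map_cons, List.prod_cons]
        refine Submodule.mul_le.2 ?_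
        rintro _ ⟨v, hv, rfl⟩ b hb
        rw [Submodule.mem_comap, AlgHom.toLinearMap_apply, map_mul, TensorAlgebra.lift_ι_apply]
        exact Submodule.mul_mem_mul (Submodule.mem_map_of_mem (hc i v hv)) (ih hb)
    · simp
  zero_one := by simp
  pos_one k hk := by simp [hk.ne']
  map_mul k a b := by
    rcases k.eq_zero_or_pos with rfl | hk
    · simp
    · rw [if_neg hk.ne', LinearMap.zero_apply, Finset.sum_eq_zero]
      intro i _
      by_cases hi : i = 0
      · simp [hi, hk.ne']
      · simp [hi]

section Unipotent

variable {h : TensorAlgebra R V →ₐ[R] TensorAlgebra R V}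

theorem sub_mem_wordGrade_succ
    (hh : ∀ n, ∀ v ∈ 𝒱 n, h (TensorAlgebra.ι R v) - TensorAlgebra.ι R v ∈ wordGrade 𝒱 n 2)
    {n : ℤ × ℤ} {m : ℕ} {x : TensorAlgebra R V} (hx : x ∈ wordGrade 𝒱 n m) :
    h x - x ∈ wordGrade 𝒱 n (m + 1) := by
  have key : ∀ l : List (ℤ × ℤ),
      (l.map fun i => Submodule.map (TensorAlgebra.ι R (M := V)) (𝒱 i)).prod ≤
        (wordGrade 𝒱 l.sum (l.length + 1)).comap (h.toLinearMap - LinearMap.id) := by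
    intro l
    induction l with
    | nil =>
      intro x hx
      obtain ⟨r, rfl⟩ := Submodule.mem_one.1 hx
      simp
    | cons i l ih =>
      rw [List.map_cons, List.prod_cons]
      refine Submodule.mul_le.2 ?_
      rintro _ ⟨v, hv, rfl⟩ b hb
      have hb1 : h b - b ∈ wordGrade 𝒱 l.sum (l.length + 1) := ih hb
      have hb0 : h b ∈ wordGrade 𝒱 l.sum l.length := by
        have := add_mem (wordGrade_anti _ l.length.le_succ hb1) (prod_le_wordGrade l hb)
        rwa [sub_add_cancel] at this
      have h1 := mul_mem_wordGrade (hh i v hv) hb0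
      have h2 := mul_mem_wordGrade (ι_mem_wordGrade hv) hb1
      rw [show 2 + l.length = l.length + 1 + 1 by omega] at h1
      rw [show 1 + (l.length + 1) = l.length + 1 + 1 by omega] at h2
      have h3 := add_mem h1 h2
      rw [sub_mul, mul_sub, sub_add_sub_cancel, ← map_mul] at h3
      simpa using h3
  suffices wordGrade 𝒱 n m ≤ (wordGrade 𝒱 n (m + 1)).comap (h.toLinearMap - LinearMap.id) from
    this hx
  refine iSup₂_le fun l hl => (key l).trans (Submodule.comap_mono ?_)
  rw [hl.1]
  exact wordGrade_anti _ (Nat.succ_le_succ hl.2)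

theorem exists_mem_tGrade_of_unipotent (h𝒱 : IsConnectedGen 𝒱)
    (hh : ∀ n, ∀ v ∈ 𝒱 n, h (TensorAlgebra.ι R v) - TensorAlgebra.ι R v ∈ wordGrade 𝒱 n 2)
    {n : ℤ × ℤ} {y : TensorAlgebra R V} (hy : y ∈ tGrade R V 𝒱 n) :
    ∃ x ∈ tGrade R V 𝒱 n, h x = y := by
  have key : ∀ d m : ℕ, n.1 + n.2 < d + m → ∀ y ∈ wordGrade 𝒱 n m,
      ∃ x ∈ tGrade R V 𝒱 n, h x = y := by
    intro d
    induction d with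
    | zero =>
      intro m hm y hy
      rw [h𝒱.wordGrade_eq_bot (by simpa using hm), Submodule.mem_bot] at hy
      exact ⟨0, zero_mem _, by simp [hy]⟩
    | succ d ih =>
      intro m hm y hy
      obtain ⟨z, hz, hzy⟩ :=
        ih (m + 1) (by push_cast at hm ⊢; omega) _ (sub_mem_wordGrade_succ hh hy)
      exact ⟨y - z, sub_mem (wordGrade_le_tGrade n m hy) hz, by simp [hzy]⟩
  rw [← wordGrade_zero] at hy
  exact key ((n.1 + n.2).toNat + 1) 0 (by push_cast; omega) y hy

theorem injective_of_unipotent (h𝒱 : IsConnectedGen 𝒱) (htop : ⨆ n, 𝒱 n = ⊤)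
    (hh : ∀ n, ∀ v ∈ 𝒱 n, h (TensorAlgebra.ι R v) - TensorAlgebra.ι R v ∈ wordGrade 𝒱 n 2) :
    Function.Injective h := by
  set N : Module.End R (TensorAlgebra R V) := h.toLinearMap - LinearMap.id with hN
  have hpow : ∀ n, ∀ x ∈ wordGrade 𝒱 n 0, ∀ j : ℕ, (N ^ j) x ∈ wordGrade 𝒱 n j := by
    intro n x hx j
    induction j with
    | zero => simpa using hx
    | succ j ih =>
      rw [pow_succ', Module.End.mul_apply]
      exact sub_mem_wordGrade_succ hh ih
  have hle : ⨆ n, wordGrade 𝒱 n 0 ≤ N.maxGenEigenspace 0 := by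
    refine iSup_le fun n x hx => (Module.End.mem_maxGenEigenspace _ _ _).2
      ⟨(n.1 + n.2).toNat + 1, ?_⟩
    have := hpow n x hx ((n.1 + n.2).toNat + 1)
    rw [h𝒱.wordGrade_eq_bot (by push_cast; omega), Submodule.mem_bot] at this
    simpa using this
  refine (injective_iff_map_eq_zero h).2 fun x hx => ?_
  have hmem : x ∈ N.maxGenEigenspace 0 := hle (iSup_wordGrade_zero htop ▸ Submodule.mem_top)
  obtain ⟨j, hj⟩ := (Module.End.mem_maxGenEigenspace _ _ _).1 hmem
  rw [zero_smul, sub_zero] at hj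
  have hneg : ∀ j : ℕ, (N ^ j) x = (-1 : R) ^ j • x := by
    intro j
    induction j with
    | zero => simp
    | succ j ih =>
      rw [pow_succ', Module.End.mul_apply, ih]
      simp [hN, hx, pow_succ']
  rw [hneg] at hj
  simpa [smul_smul, ← mul_pow] using congrArg (fun y => (-1 : R) ^ j • y) hj

end Unipotent

/-- If the zeroth component of the first component of `f` has a graded inverse, then `f 0` is
bijective and reflects the grading. -/
theorem IsMultiAlgHom.bijective_zero (hf : IsMultiAlgHom 𝒱 𝒱' f) (h𝒱 : IsConnectedGen 𝒱)
    (h𝒱' : IsConnectedGen 𝒱') (htop : ⨆ n, 𝒱 n = ⊤) (htop' : ⨆ n, 𝒱' n = ⊤)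
    {c : V' →ₗ[R] V} (hc : ∀ n, ∀ v ∈ 𝒱' n, c v ∈ 𝒱 n)
    (hr : (linPart f 0).comp c = LinearMap.id) (hl : c.comp (linPart f 0) = LinearMap.id) :
    Function.Bijective (f 0) ∧
      ∀ n, ∀ y ∈ tGrade R V' 𝒱' n, ∃ x ∈ tGrade R V 𝒱 n, f 0 x = y := by
  have hφ := isMultiAlgHom_lift hc
  set φ : ℕ → (TensorAlgebra R V' →ₗ[R] TensorAlgebra R V) := fun k =>
    if k = 0 then (TensorAlgebra.lift R ((TensorAlgebra.ι R).comp c)).toLinearMap else 0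
  have hφc : linPart φ 0 = c := by
    ext v
    simp [linPart, φ, ιInv_ι]
  have unip : ∀ {W W' : Type} [AddCommGroup W] [Module R W] [AddCommGroup W'] [Module R W']
      {𝒲 : ℤ × ℤ → Submodule R W} {𝒲' : ℤ × ℤ → Submodule R W'}
      {a : ℕ → (TensorAlgebra R W →ₗ[R] TensorAlgebra R W')}
      {b : ℕ → (TensorAlgebra R W' →ₗ[R] TensorAlgebra R W)}
      (ha : IsMultiAlgHom 𝒲 𝒲' a) (hb : IsMultiAlgHom 𝒲' 𝒲 b)
      (_ : IsConnectedGen 𝒲) (_ : IsConnectedGen 𝒲') (_ : ⨆ n, 𝒲 n = ⊤)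
      (_ : (linPart b 0).comp (linPart a 0) = LinearMap.id), ∀ n, ∀ v ∈ 𝒲 n,
      (hb.zeroHom.comp ha.zeroHom) (TensorAlgebra.ι R v) - TensorAlgebra.ι R v ∈
        wordGrade 𝒲 n 2 := by
    intro W W' _ _ _ _ 𝒲 𝒲' a b ha hb h𝒲 h𝒲' h𝒲top hba n v hv
    have hmem : b 0 (a 0 (TensorAlgebra.ι R v)) ∈ wordGrade 𝒲 n 1 := by
      simpa using hb.map_wordGrade h𝒲' (ha.map_ι_mem h𝒲 hv 0) 0
    have hlin : TensorAlgebra.ιInv (b 0 (a 0 (TensorAlgebra.ι R v))) = v := by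
      have h0 := LinearMap.congr_fun (congrFun (hb.linPart_convE ha h𝒲 h𝒲' h𝒲top) 0) v
      have h1 := LinearMap.congr_fun hba v
      simp only [convE, linPart, zero_add, Finset.sum_range_one, Nat.sub_zero,
        LinearMap.comp_apply, LinearMap.id_apply] at h0 h1
      exact h0.symm.trans h1
    have := sub_ι_ιInv_mem_wordGrade hmem
    rwa [hlin] at this
  have hu := unip hf hφ h𝒱 h𝒱' htop (by rw [hφc, hl])
  have hu' := unip hφ hf h𝒱' h𝒱 htop' (by rw [hφc, hr])
  have hsurj : ∀ n, ∀ y ∈ tGrade R V' 𝒱' n, ∃ x ∈ tGrade R V 𝒱 n, f 0 x = y := by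
    intro n y hy
    obtain ⟨z, hz, hzy⟩ := exists_mem_tGrade_of_unipotent h𝒱' hu' hy
    exact ⟨φ 0 z, by simpa using hφ.map_grade 0 n z hz, hzy⟩
  refine ⟨⟨?_, ?_⟩, hsurj⟩
  · have := injective_of_unipotent h𝒱 htop hu
    rw [AlgHom.coe_comp] at this
    exact this.of_comp
  · rw [← LinearMap.range_eq_top, eq_top_iff, ← iSup_wordGrade_zero htop']
    refine iSup_le fun n y hy => ?_
    obtain ⟨x, -, hx⟩ := hsurj n y (wordGrade_le_tGrade n 0 hy)
    exact ⟨x, hx⟩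

open Finset in
theorem IsMultiAlgHom.exists_inverse (hf : IsMultiAlgHom 𝒱 𝒱' f)
    (hbij : Function.Bijective (f 0))
    (hsurj : ∀ n, ∀ y ∈ tGrade R V' 𝒱' n, ∃ x ∈ tGrade R V 𝒱 n, f 0 x = y) :
    ∃ g, IsMultiAlgHom 𝒱' 𝒱 g ∧ convE R f g = idE R (TensorAlgebra R V') ∧
      convE R g f = idE R (TensorAlgebra R V) := by
  set e := LinearEquiv.ofBijective (f 0) hbij
  have hef : ∀ x, e.symm (f 0 x) = x := e.symm_apply_apply
  have hfe : (f 0).comp e.symm.toLinearMap = LinearMap.id :=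
    LinearMap.ext fun y => e.apply_symm_apply y
  have he : ∀ n, ∀ y ∈ tGrade R V' 𝒱' n, e.symm y ∈ tGrade R V 𝒱 n := by
    intro n y hy
    obtain ⟨x, hx, rfl⟩ := hsurj n y hy
    rwa [hef]
  set g := convInv f e.symm.toLinearMap with hg
  have hfg : convE R f g = idE R _ := convE_convInv hfe
  have hfg' : ∀ k y, ∑ p ∈ antidiagonal k, f p.1 (g p.2 y) = if k = 0 then y else 0 := by
    intro k y
    rw [← convE_apply, hfg]
    by_cases hk : k = 0 <;> simp [idE, hk]
  have hone : (fun k => g k 1) = fun k => if k = 0 then 1 else 0 := by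
    refine conv_injective hbij.1 fun k => ?_
    rw [hfg', sum_eq_single (k, 0)]
    · rcases k.eq_zero_or_pos with rfl | hk
      · simp [hf.zero_one]
      · simp [hf.pos_one k hk, hk.ne']
    · rintro ⟨i, j⟩ hij hne
      rw [if_neg, map_zero]
      rintro rfl
      exact hne (by simpa using hij)
    · simp
  refine ⟨g, ⟨?_, by simpa using congrFun hone 0, fun k hk => ?_, fun k a b => ?_⟩, hfg,
    convE_eq_id_symm hbij.1 hfg⟩
  · intro k
    induction k using Nat.strong_induction_on with
    | _ k ih =>
      intro n y hy
      cases k with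
      | zero => simpa [hg, convInv] using he n y hy
      | succ k =>
        rw [hg, convInv_succ]
        simp only [LinearMap.neg_apply, LinearMap.comp_apply, LinearMap.sum_apply]
        refine neg_mem (he _ _ (sum_mem fun i hi => ?_))
        have hik : i ≤ k := Nat.lt_succ_iff.1 (mem_range.1 hi)
        convert hf.map_grade (i + 1) _ _ (ih (k - i) (by omega) n y hy) using 2
        ext <;> simp [Nat.cast_sub hik] <;> ring
  · simpa [hk.ne'] using congrFun hone k
  · rw [← Nat.sum_antidiagonal_eq_sum_range_succ (fun i j => g i a * g j b)]
    refine congrFun (conv_injective (u := fun k => g k (a * b)) (w := fun k => ∑ p ∈ antidiagonal k, g p.1 a * g p.2 b)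
      hbij.1 fun k => ?_) k
    have hfmul : ∀ k x y, f k (x * y) = ∑ p ∈ antidiagonal k, f p.1 x * f p.2 y := by
      intro k x y
      rw [hf.map_mul, Nat.sum_antidiagonal_eq_sum_range_succ (fun i j => f i x * f j y)]
    rw [hfg']
    simp_rw [map_sum, hfmul]
    rw [Nat.sum_antidiagonal_interchange (fun i j l m => f i (g j a) * f l (g m b))]
    simp_rw [← mul_sum, ← sum_mul, hfg']
    rcases k.eq_zero_or_pos with rfl | hk
    · simp
    · rw [if_neg hk.ne', sum_eq_zero]
      rintro ⟨i, j⟩ hij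
      by_cases hi : i = 0
      · have hj : j ≠ 0 := by
          have := HasAntidiagonal.mem_antidiagonal.1 hij
          simp only at this
          omega
        simp [hj]
      · simp [hi]

end WordGrade

/-- Lemma 2.3.1.  A multimorphism of bigraded algebras
`f : T[V] → T[V']` between tensor algebras on free connected bigraded modules is an
isomorphism of bigraded algebras if and only if its first component
`α₁ = ιInv ∘ f ∘ ι : V → V'` is an isomorphism of bigraded `R`-modules. -/
theorem minimal_multi_models_stmt6 (R V V' : Type) [CommRing R]
    [AddCommGroup V] [Module R V] [Module.Free R V]
    [AddCommGroup V'] [Module R V'] [Module.Free R V']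
    (𝒱 : ℤ × ℤ → Submodule R V) (𝒱' : ℤ × ℤ → Submodule R V')
    (hV : IsFreeConnectedGen R V 𝒱) (hV' : IsFreeConnectedGen R V' 𝒱')
    (f : ℕ → (TensorAlgebra R V →ₗ[R] TensorAlgebra R V'))
    (hgr : ∀ (k : ℕ) (pq : ℤ × ℤ), ∀ a ∈ tGrade R V 𝒱 pq,
      f k a ∈ tGrade R V' 𝒱' (pq.1 - k, pq.2 + k))
    (hone : f 0 1 = 1) (hone' : ∀ k, 0 < k → f k 1 = 0)
    (hmul : ∀ (k : ℕ) (a b : TensorAlgebra R V),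
      f k (a * b) = ∑ i ∈ Finset.range (k + 1), f i a * f (k - i) b) :
    (∃ g : ℕ → (TensorAlgebra R V' →ₗ[R] TensorAlgebra R V),
      (∀ (k : ℕ) (pq : ℤ × ℤ), ∀ a ∈ tGrade R V' 𝒱' pq,
        g k a ∈ tGrade R V 𝒱 (pq.1 - k, pq.2 + k)) ∧
      g 0 1 = 1 ∧ (∀ k, 0 < k → g k 1 = 0) ∧
      (∀ (k : ℕ) (a b : TensorAlgebra R V'),
        g k (a * b) = ∑ i ∈ Finset.range (k + 1), g i a * g (k - i) b) ∧
      convE R f g = idE R (TensorAlgebra R V') ∧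
      convE R g f = idE R (TensorAlgebra R V)) ↔
    (∃ γ : ℕ → (V' →ₗ[R] V),
      (∀ (k : ℕ) (pq : ℤ × ℤ), ∀ v ∈ 𝒱' pq, γ k v ∈ 𝒱 (pq.1 - k, pq.2 + k)) ∧
      convE R (fun k => (TensorAlgebra.ιInv (R := R) (M := V')).comp
          ((f k).comp (TensorAlgebra.ι R))) γ = idE R V' ∧
      convE R γ (fun k => (TensorAlgebra.ιInv (R := R) (M := V')).comp
          ((f k).comp (TensorAlgebra.ι R))) = idE R V) := by
  have htop := hV.1.submodule_iSup_eq_top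
  have htop' := hV'.1.submodule_iSup_eq_top
  have hf : IsMultiAlgHom 𝒱 𝒱' f := ⟨hgr, hone, hone', hmul⟩
  constructor
  · rintro ⟨g, hggr, hgone, hgone', hgmul, hfg, hgf⟩
    have hg : IsMultiAlgHom 𝒱' 𝒱 g := ⟨hggr, hgone, hgone', hgmul⟩
    refine ⟨linPart g, fun k pq v hv => hg.linPart_mem hv k, ?_, ?_⟩
    · exact (hf.linPart_convE hg hV'.2.1 hV.2.1 htop').trans (by rw [hfg, linPart_idE])
    · exact (hg.linPart_convE hf hV.2.1 hV'.2.1 htop).trans (by rw [hgf, linPart_idE])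
  · rintro ⟨γ, hγ, hr, hl⟩
    obtain ⟨hbij, hsurj⟩ := hf.bijective_zero hV.2.1 hV'.2.1 htop htop'
      (c := γ 0) (fun n v hv => by simpa using hγ 0 n v hv)
      (by simpa [convE, idE, linPart] using congrFun hr 0) (by simpa [convE, idE, linPart] using congrFun hl 0)
    obtain ⟨g, hg, hfg, hgf⟩ := hf.exists_inverse hbij hsurj
    exact ⟨g, hg.map_grade, hg.zero_one, hg.pos_one, hg.map_mul, hfg, hgf⟩
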